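/- arXiv:1409.0136 — 2 statements merged into one kernel-verified Lean document; each statement's English description precedes it below -/
import Mathlib

section
/- Let V be a finite nonempty set with N = |V| elements, and let ~ be a random equivalence relation on V defined on some probability space. For x ∈ V let C(x) denote the (random) equivalence class of x, and let |M| = max_{x ∈ V} |C(x)| be the size of a largest class. Then for every ε > 0: E[|M|]/N ≤ max_{x ∈ V} P(|C(x)| > εN) + ε. -/
open MeasureTheory ProbabilityTheory
open scoped ENNReal

/-- Let `V` be a finite nonempty set with `N` elements and let `C : Ω → V →
Finset V` be the classes of a random equivalence relation on `V` (so that `x ∈ C ω x` and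
`y ∈ C ω x → C ω y = C ω x`). With `|M| = max_x |C(x)|` the size of a largest class, for every
`ε > 0` one has `E[|M|]/N ≤ max_x P(|C(x)| > εN) + ε`. -/
theorem stmt11 {Ω : Type*} [MeasurableSpace Ω] (P : Measure Ω) [IsProbabilityMeasure P]
    (V : Type*) [Fintype V] [Nonempty V] [DecidableEq V]
    (C : Ω → V → Finset V)
    (hrefl : ∀ ω x, x ∈ C ω x)
    (hclass : ∀ ω x y, y ∈ C ω x → C ω y = C ω x)
    (hmeas : ∀ x, Measurable fun ω => (C ω x).card)
    (ε : ℝ) (hε : 0 < ε) :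
    (∫ ω, ((Finset.univ.sup fun x : V => (C ω x).card : ℕ) : ℝ) ∂P) / Fintype.card V
      ≤ (Finset.univ.sup' Finset.univ_nonempty fun x : V =>
          (P {ω | ε * Fintype.card V < ((C ω x).card : ℝ)}).toReal) + ε := by
  have hN : (0 : ℝ) < Fintype.card V := by exact_mod_cast Fintype.card_pos
  have hms : ∀ x : V, MeasurableSet {ω | ε * Fintype.card V < ((C ω x).card : ℝ)} := by
    intro x
    exact measurableSet_lt measurable_const (measurable_from_top.comp (hmeas x))
  have hint : ∀ x : V, Integrable
      ({ω | ε * Fintype.card V < ((C ω x).card : ℝ)}.indicator (fun _ => (1 : ℝ))) P :=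
    fun x => (integrable_const (1 : ℝ)).indicator (hms x)
  have hsum : Integrable (fun ω => ∑ x : V,
      {ω | ε * Fintype.card V < ((C ω x).card : ℝ)}.indicator (fun _ => (1 : ℝ)) ω) P :=
    integrable_finsetSum _ fun x _ => hint x
  have hpt : ∀ ω, ((Finset.univ.sup fun x : V => (C ω x).card : ℕ) : ℝ) ≤
      ε * Fintype.card V + ∑ x : V,
        {ω | ε * Fintype.card V < ((C ω x).card : ℝ)}.indicator (fun _ => (1 : ℝ)) ω := by
    intro ω
    obtain ⟨z, -, hz⟩ := Finset.exists_mem_eq_sup Finset.univ Finset.univ_nonempty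
      (fun x : V => (C ω x).card)
    rw [hz]
    have hnn : ∀ x : V, 0 ≤
        {ω | ε * Fintype.card V < ((C ω x).card : ℝ)}.indicator (fun _ => (1 : ℝ)) ω :=
      fun x => Set.indicator_nonneg (fun _ _ => zero_le_one) _
    by_cases h : ε * Fintype.card V < ((C ω z).card : ℝ)
    · have h1 : ((C ω z).card : ℝ) = ∑ x ∈ C ω z,
          {ω | ε * Fintype.card V < ((C ω x).card : ℝ)}.indicator (fun _ => (1 : ℝ)) ω := by
        rw [Finset.sum_congr rfl (g := fun _ => (1 : ℝ))]
        · simp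
        · intro x hx
          apply Set.indicator_of_mem
          simp only [Set.mem_ofPred_eq]
          rw [hclass ω z x hx]
          exact h
      have h2 := Finset.sum_le_sum_of_subset_of_nonneg (Finset.subset_univ (C ω z))
        (fun x _ _ => hnn x)
      have h3 : 0 ≤ ε * Fintype.card V := by positivity
      linarith
    · have := Finset.sum_nonneg (fun x (_ : x ∈ Finset.univ) => hnn x)
      linarith
  have hI := integral_mono_of_nonneg (μ := P) (Filter.Eventually.of_forall
    (fun ω => Nat.cast_nonneg _)) ((integrable_const (ε * (Fintype.card V : ℝ))).add hsum)
    (Filter.Eventually.of_forall hpt)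
  simp only [Pi.add_apply] at hI
  rw [integral_add (integrable_const _) hsum, integral_finsetSum _ (fun x _ => hint x)] at hI
  simp only [integral_indicator_const _ (hms _), integral_const, probReal_univ, smul_eq_mul,
    one_mul, mul_one] at hI
  have hS := Finset.sum_le_card_nsmul Finset.univ
    (fun x : V => P.real {ω | ε * Fintype.card V < ((C ω x).card : ℝ)})
    (Finset.univ.sup' Finset.univ_nonempty fun x : V =>
          (P {ω | ε * Fintype.card V < ((C ω x).card : ℝ)}).toReal)
    (fun x hx => Finset.le_sup' (fun x : V =>
          (P {ω | ε * Fintype.card V < ((C ω x).card : ℝ)}).toReal) hx)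
  rw [nsmul_eq_mul, Finset.card_univ] at hS
  rw [div_le_iff₀ hN]
  linarith
end

section
/- Let V be a finite nonempty set with N = |V| elements, and let ~ be a random equivalence relation on V defined on some probability space. For x ∈ V let C(x) denote the (random) equivalence class of x, and let |M| = max_{x ∈ V} |C(x)| be the size of a largest class. Then E[|M|]/N ≤ 2 · √( max_{x ∈ V} E[|C(x)|] / N ). -/
open MeasureTheory ProbabilityTheory
open scoped ENNReal

/-- Let `V` be a finite nonempty set with `N` elements and let `C : Ω → V →
Finset V` be the classes of a random equivalence relation on `V` (so that `x ∈ C ω x` and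
`y ∈ C ω x → C ω y = C ω x`). With `|M| = max_x |C(x)|` the size of a largest class, one has
`E[|M|]/N ≤ 2 √(max_x E[|C(x)|] / N)`. -/
theorem stmt12 {Ω : Type*} [MeasurableSpace Ω] (P : Measure Ω) [IsProbabilityMeasure P]
    (V : Type*) [Fintype V] [Nonempty V] [DecidableEq V]
    (C : Ω → V → Finset V)
    (hrefl : ∀ ω x, x ∈ C ω x)
    (hclass : ∀ ω x y, y ∈ C ω x → C ω y = C ω x)
    (hmeas : ∀ x, Measurable fun ω => (C ω x).card) :
    (∫ ω, ((Finset.univ.sup fun x : V => (C ω x).card : ℕ) : ℝ) ∂P) / Fintype.card V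
      ≤ 2 * Real.sqrt ((Finset.univ.sup' Finset.univ_nonempty fun x : V =>
          ∫ ω, ((C ω x).card : ℝ) ∂P) / Fintype.card V) := by
  classical
  set M : Ω → ℕ := fun ω => Finset.univ.sup fun x : V => (C ω x).card with hM
  set S : ℝ := Finset.univ.sup' Finset.univ_nonempty fun x : V =>
          ∫ ω, ((C ω x).card : ℝ) ∂P with hS
  have hbd : ∀ ω x, (C ω x).card ≤ Fintype.card V := fun ω x => Finset.card_le_univ _
  have hMbd : ∀ ω, M ω ≤ Fintype.card V := fun ω => Finset.sup_le fun x _ => hbd ω x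
  have hMm : Measurable M := by
    have h : ∀ s : Finset V, Measurable fun ω => s.sup fun x : V => (C ω x).card := by
      intro s
      induction s using Finset.induction_on with
      | empty => simp
      | insert x s hx ih =>
        simp only [Finset.sup_insert]
        exact (hmeas x).sup ih
    exact h _
  have hcast : Measurable (fun n : ℕ => (n : ℝ)) := measurable_from_top
  have hMi : Integrable (fun ω => (M ω : ℝ)) P := by
    refine Integrable.of_bound (hcast.comp hMm).aestronglyMeasurable (Fintype.card V : ℝ) ?_
    refine Filter.Eventually.of_forall fun ω => ?_
    simpa using hMbd ω
  have hCi : ∀ x, Integrable (fun ω => ((C ω x).card : ℝ)) P := by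
    intro x
    refine Integrable.of_bound (hcast.comp (hmeas x)).aestronglyMeasurable
      (Fintype.card V : ℝ) ?_
    refine Filter.Eventually.of_forall fun ω => ?_
    simpa using hbd ω x
  have hsq : ∀ ω, M ω * M ω ≤ ∑ x, (C ω x).card := by
    intro ω
    obtain ⟨x, -, hx⟩ := Finset.exists_mem_eq_sup (Finset.univ : Finset V)
      Finset.univ_nonempty (fun x => (C ω x).card)
    have hx' : M ω = (C ω x).card := hx
    calc M ω * M ω = ∑ y ∈ C ω x, (C ω y).card := by
          rw [Finset.sum_congr rfl (fun y hy => by rw [hclass ω x y hy])]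
          simp [hx']
      _ ≤ _ := Finset.sum_le_sum_of_subset (Finset.subset_univ _)
  set a : ℝ := ∫ ω, (M ω : ℝ) ∂P with ha
  have ha0 : 0 ≤ a := integral_nonneg fun ω => Nat.cast_nonneg _
  have hNpos : (0 : ℝ) < Fintype.card V := by exact_mod_cast Fintype.card_pos
  have h1 : ∫ ω, (2 * a * (M ω : ℝ) - a ^ 2) ∂P ≤ ∫ ω, ∑ x, ((C ω x).card : ℝ) ∂P := by
    refine integral_mono ((hMi.const_mul _).sub (integrable_const _))
      (integrable_finsetSum _ fun x _ => hCi x) fun ω => ?_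
    have h : (M ω : ℝ) * M ω ≤ ∑ x, ((C ω x).card : ℝ) := by exact_mod_cast hsq ω
    show 2 * a * (M ω : ℝ) - a ^ 2 ≤ ∑ x, ((C ω x).card : ℝ)
    nlinarith [sq_nonneg ((M ω : ℝ) - a)]
  rw [integral_sub (hMi.const_mul _) (integrable_const _), integral_const_mul,
    integral_finsetSum _ (fun x _ => hCi x)] at h1
  have h2 : ∑ x, ∫ ω, ((C ω x).card : ℝ) ∂P ≤ Fintype.card V * S := by
    calc _ ≤ ∑ _x : V, S := Finset.sum_le_sum fun x hx =>
          Finset.le_sup' (fun x : V => ∫ ω, ((C ω x).card : ℝ) ∂P) hx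
      _ = _ := by simp
  have h3 : a ^ 2 ≤ Fintype.card V * S := by
    simp only [integral_const, probReal_univ, one_smul, ← ha] at h1
    nlinarith
  have h4 : a / Fintype.card V ≤ Real.sqrt (S / Fintype.card V) := by
    apply Real.le_sqrt_of_sq_le
    rw [div_pow, div_le_div_iff₀ (by positivity) hNpos]
    nlinarith
  have h5 := Real.sqrt_nonneg (S / Fintype.card V)
  show a / Fintype.card V ≤ _
  linarith
end
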